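/- The ℤ-algebra homomorphism from the polynomial ring ℤ[T_1, T_2, T_3, T_4, T_5, T_6] to B_5(ℤ) sending T_1 ↦ a, T_2 ↦ c_4, T_3 ↦ c̄_4, T_4 ↦ c_5, T_5 ↦ c̄_5, T_6 ↦ c_{45} is an isomorphism of ℤ-algebras; that is, U_5 is isomorphic to the affine space A^6 over ℤ with coordinates a, c_4, c̄_4, c_5, c̄_5, c_{45}. Explicitly: the quotient of ℤ[a, c, c̄, c_4, c̄_4, c_5, c̄_5, c_{45}] by the two relations (c_5 − c_4)·c_{45} = (a + c̄_4 + c_5 + c̄_5)·c_5 − c and (c̄_4 − c̄_5)·c_{45} = (a + c_4 + c̄_4 + c_5)·c̄_4 − c̄ is isomorphic to a polynomial ring over ℤ in six variables. -/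

import Mathlib

noncomputable section

open MvPolynomial

/-- Generators of the ring `B_n(R)`: `a`, `c`, `c̄`, `c_i`, `c̄_i` (`4 ≤ i ≤ n`)
and `c_{ij}` (`4 ≤ i < j ≤ n`). -/
inductive BVar (n : ℕ) : Type where
  | A : BVar n
  | Cc : BVar n
  | Cb : BVar n
  | lo : {i : ℕ // 4 ≤ i ∧ i ≤ n} → BVar n
  | hi : {i : ℕ // 4 ≤ i ∧ i ≤ n} → BVar n
  | mix : {p : ℕ × ℕ // 4 ≤ p.1 ∧ p.1 < p.2 ∧ p.2 ≤ n} → BVar n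

/-- The generator `a` as a polynomial. -/
def pA (n : ℕ) (R : Type*) [CommRing R] : MvPolynomial (BVar n) R := X BVar.A

/-- The generator `c` as a polynomial. -/
def pC (n : ℕ) (R : Type*) [CommRing R] : MvPolynomial (BVar n) R := X BVar.Cc

/-- The generator `c̄` as a polynomial. -/
def pCb (n : ℕ) (R : Type*) [CommRing R] : MvPolynomial (BVar n) R := X BVar.Cb

/-- The generator `c_i` as a polynomial (junk value `0` if `i` is out of range). -/
def pLo (n : ℕ) (R : Type*) [CommRing R] (i : ℕ) : MvPolynomial (BVar n) R :=
  if h : 4 ≤ i ∧ i ≤ n then X (BVar.lo ⟨i, h⟩) else 0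

/-- The generator `c̄_i` as a polynomial (junk value `0` if `i` is out of range). -/
def pHi (n : ℕ) (R : Type*) [CommRing R] (i : ℕ) : MvPolynomial (BVar n) R :=
  if h : 4 ≤ i ∧ i ≤ n then X (BVar.hi ⟨i, h⟩) else 0

/-- The generator `c_{ij}` (for `4 ≤ i < j ≤ n`) as a polynomial
(junk value `0` if out of range). -/
def pMix (n : ℕ) (R : Type*) [CommRing R] (i j : ℕ) : MvPolynomial (BVar n) R :=
  if h : 4 ≤ i ∧ i < j ∧ j ≤ n then X (BVar.mix ⟨(i, j), h⟩) else 0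

/-- The abbreviation `c_{ji} := a + c_i + c̄_i + c_j + c̄_j − c_{ij}` for `i < j`. -/
def pMixRev (n : ℕ) (R : Type*) [CommRing R] (i j : ℕ) : MvPolynomial (BVar n) R :=
  pA n R + pLo n R i + pHi n R i + pLo n R j + pHi n R j - pMix n R i j

/-- The defining relations (R1), (R2), (R3) of `B_n(R)`. -/
def bRels (n : ℕ) (R : Type*) [CommRing R] : Set (MvPolynomial (BVar n) R) :=
  {p | ∃ i j : ℕ, 4 ≤ i ∧ i < j ∧ j ≤ n ∧
      p = (pLo n R j - pLo n R i) * pMix n R i j -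
          ((pA n R + pHi n R i + pLo n R j + pHi n R j) * pLo n R j - pC n R)} ∪
  {p | ∃ i j : ℕ, 4 ≤ i ∧ i < j ∧ j ≤ n ∧
      p = (pHi n R i - pHi n R j) * pMix n R i j -
          ((pA n R + pLo n R i + pHi n R i + pLo n R j) * pHi n R i - pCb n R)} ∪
  {p | ∃ i j k : ℕ, 4 ≤ i ∧ i < j ∧ j < k ∧ k ≤ n ∧
      p = pMix n R i j * pMix n R j k + pMixRev n R i j * pMix n R i k -
          pMix n R i k * pMix n R j k +
          (pA n R + pLo n R k + pHi n R k) * pLo n R k - pC n R}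

/-- The ideal of relations of `B_n(R)`. -/
def bIdeal (n : ℕ) (R : Type*) [CommRing R] : Ideal (MvPolynomial (BVar n) R) :=
  Ideal.span (bRels n R)

/-- The ring `B_n(R)`. -/
abbrev BRing (n : ℕ) (R : Type*) [CommRing R] := MvPolynomial (BVar n) R ⧸ bIdeal n R

/-- The quotient projection onto `B_n(R)`. -/
def bmk (n : ℕ) (R : Type*) [CommRing R] : MvPolynomial (BVar n) R →+* BRing n R :=
  Ideal.Quotient.mk (bIdeal n R)

section FivePoints

variable (R : Type*) [CommRing R]

/-- The values of the generators of `B_5(R)` in the polynomial ring in six variables, obtained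
by solving (R1) for `c` and (R2) for `c̄`. -/
def bFiveVal : BVar 5 → MvPolynomial (Fin 6) R
  | .A => X 0
  | .Cc => (X 0 + X 2 + X 3 + X 4) * X 3 - (X 3 - X 1) * X 5
  | .Cb => (X 0 + X 1 + X 2 + X 3) * X 2 - (X 2 - X 4) * X 5
  | .lo i => if i.1 = 4 then X 1 else X 3
  | .hi i => if i.1 = 4 then X 2 else X 4
  | .mix _ => X 5

/-- The six polynomial generators of `B_5(R)`. -/
def bFiveGen : Fin 6 → MvPolynomial (BVar 5) R :=
  ![pA 5 R, pLo 5 R 4, pHi 5 R 4, pLo 5 R 5, pHi 5 R 5, pMix 5 R 4 5]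

/-- The map from the polynomial ring in six variables to `B_5(R)`. -/
def bFiveHom : MvPolynomial (Fin 6) R →ₐ[R] BRing 5 R :=
  aeval fun i => Ideal.Quotient.mkₐ R (bIdeal 5 R) (bFiveGen R i)

theorem aeval_bFiveVal_eq_zero {p : MvPolynomial (BVar 5) R} (hp : p ∈ bIdeal 5 R) :
    aeval (bFiveVal R) p = 0 := by
  suffices h : bIdeal 5 R ≤ RingHom.ker (aeval (bFiveVal R)) from h hp
  refine Ideal.span_le.2 ?_
  rintro p ((⟨i, j, hi, hij, hj, rfl⟩ | ⟨i, j, hi, hij, hj, rfl⟩) |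
    ⟨i, j, k, hi, hij, hjk, hk, -⟩)
  · obtain ⟨rfl, rfl⟩ : i = 4 ∧ j = 5 := by omega
    simp [pA, pC, pLo, pHi, pMix, bFiveVal]
  · obtain ⟨rfl, rfl⟩ : i = 4 ∧ j = 5 := by omega
    simp [pA, pCb, pLo, pHi, pMix, bFiveVal]
  · omega

/-- The map from `B_5(R)` to the polynomial ring in six variables. -/
def bFiveInv : BRing 5 R →ₐ[R] MvPolynomial (Fin 6) R :=
  Ideal.Quotient.liftₐ (bIdeal 5 R) (aeval (bFiveVal R)) fun _ => aeval_bFiveVal_eq_zero R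

theorem bFiveInv_mk (p : MvPolynomial (BVar 5) R) :
    bFiveInv R (Ideal.Quotient.mk (bIdeal 5 R) p) = aeval (bFiveVal R) p := rfl

theorem bFiveHom_X (i : Fin 6) :
    bFiveHom R (X i) = Ideal.Quotient.mk (bIdeal 5 R) (bFiveGen R i) := by
  simp [bFiveHom]

theorem bFiveInv_comp_bFiveHom : (bFiveInv R).comp (bFiveHom R) = AlgHom.id R _ := by
  refine MvPolynomial.algHom_ext fun i => ?_
  rw [AlgHom.comp_apply, bFiveHom_X, bFiveInv_mk]
  fin_cases i <;> simp [bFiveGen, bFiveVal, pA, pLo, pHi, pMix]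

theorem bFiveHom_bFiveVal (v : BVar 5) :
    bFiveHom R (bFiveVal R v) = Ideal.Quotient.mk (bIdeal 5 R) (X v) := by
  match v with
  | .A => simp [bFiveVal, bFiveHom_X, bFiveGen, pA]
  | .Cc =>
    simp only [bFiveVal, map_sub, map_mul, map_add, bFiveHom_X]
    simp only [← map_sub, ← map_mul, ← map_add]
    refine Ideal.Quotient.eq.2 ?_
    rw [← neg_mem_iff]
    refine Ideal.subset_span (Or.inl (Or.inl ⟨4, 5, by omega, by omega, le_rfl, ?_⟩))
    simp only [bFiveGen, pC, Matrix.cons_val]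
    ring
  | .Cb =>
    simp only [bFiveVal, map_sub, map_mul, map_add, bFiveHom_X]
    simp only [← map_sub, ← map_mul, ← map_add]
    refine Ideal.Quotient.eq.2 ?_
    rw [← neg_mem_iff]
    refine Ideal.subset_span (Or.inl (Or.inr ⟨4, 5, by omega, by omega, le_rfl, ?_⟩))
    simp only [bFiveGen, pCb, Matrix.cons_val]
    ring
  | .lo ⟨i, hi⟩ =>
    obtain rfl | rfl : i = 4 ∨ i = 5 := by omega
    all_goals simp [bFiveVal, bFiveHom_X, bFiveGen, pLo]
  | .hi ⟨i, hi⟩ =>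
    obtain rfl | rfl : i = 4 ∨ i = 5 := by omega
    all_goals simp [bFiveVal, bFiveHom_X, bFiveGen, pHi]
  | .mix ⟨(i, j), h⟩ =>
    obtain ⟨rfl, rfl⟩ : i = 4 ∧ j = 5 := by simp only at h; omega
    simp [bFiveVal, bFiveHom_X, bFiveGen, pMix]

theorem bFiveHom_comp_bFiveInv : (bFiveHom R).comp (bFiveInv R) = AlgHom.id R _ := by
  refine Ideal.Quotient.algHom_ext R (MvPolynomial.algHom_ext fun v => ?_)
  simp [bFiveInv_mk, bFiveHom_bFiveVal]

/-- `B_5(R)` is a polynomial ring in six variables. -/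
def bFiveEquiv : MvPolynomial (Fin 6) R ≃ₐ[R] BRing 5 R :=
  AlgEquiv.ofAlgHom (bFiveHom R) (bFiveInv R) (bFiveHom_comp_bFiveInv R)
    (bFiveInv_comp_bFiveHom R)

end FivePoints

/-- Proposition 1.5(i), case `n = 5`: the `ℤ`-algebra map
`ℤ[T₁,…,T₆] → B₅(ℤ)` sending `T₁ ↦ a`, `T₂ ↦ c₄`, `T₃ ↦ c̄₄`, `T₄ ↦ c₅`, `T₅ ↦ c̄₅`,
`T₆ ↦ c₄₅` is an isomorphism; i.e. `U₅ ≅ 𝔸⁶` over `ℤ`. -/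
theorem stmt2 :
    ∃ e : MvPolynomial (Fin 6) ℤ ≃ₐ[ℤ] BRing 5 ℤ,
      e (X 0) = bmk 5 ℤ (pA 5 ℤ) ∧
      e (X 1) = bmk 5 ℤ (pLo 5 ℤ 4) ∧
      e (X 2) = bmk 5 ℤ (pHi 5 ℤ 4) ∧
      e (X 3) = bmk 5 ℤ (pLo 5 ℤ 5) ∧
      e (X 4) = bmk 5 ℤ (pHi 5 ℤ 5) ∧
      e (X 5) = bmk 5 ℤ (pMix 5 ℤ 4 5) := by
  exact ⟨bFiveEquiv ℤ, bFiveHom_X ℤ 0, bFiveHom_X ℤ 1, bFiveHom_X ℤ 2, bFiveHom_X ℤ 3,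
    bFiveHom_X ℤ 4, bFiveHom_X ℤ 5⟩
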